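/- Let ℓ be a bounded scoring loss, P a PMF on X × Y, and h : X → Δ^Y any predictor. Then RF_P(h,ℓ) ≥ B_P(ℓ); i.e., the refinement of any predictor is at least the expected generalized entropy of the true conditional distributions. -/

import Mathlib

open Finset
open scoped Classical

noncomputable section

/-- The standard probability simplex over a finite type `Y`. -/
def simplex (Y : Type*) [Fintype Y] : Set (Y → ℝ) :=
  {p | (∀ y, 0 ≤ p y) ∧ ∑ y, p y = 1}

variable {X Y : Type*}

/-- Expected loss `L(p,q) = Σ_y p(y)·ℓ(y,q)`. -/
def expLoss [Fintype Y] (ℓ : Y → (Y → ℝ) → ℝ) (p q : Y → ℝ) : ℝ :=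
  ∑ y, p y * ℓ y q

/-- A scoring loss is bounded by `M` if `0 ≤ ℓ(y,q) ≤ M` for all `y` and `q ∈ Δ^Y`. -/
def IsBoundedLoss [Fintype Y] (ℓ : Y → (Y → ℝ) → ℝ) (M : ℝ) : Prop :=
  ∀ y : Y, ∀ q ∈ simplex Y, 0 ≤ ℓ y q ∧ ℓ y q ≤ M

/-- A scoring loss is proper if `L(p,p) ≤ L(p,q)` for all `p, q ∈ Δ^Y`. -/
def IsProper [Fintype Y] (ℓ : Y → (Y → ℝ) → ℝ) : Prop :=
  ∀ p ∈ simplex Y, ∀ q ∈ simplex Y, expLoss ℓ p p ≤ expLoss ℓ p q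

/-- Generalized entropy `H_ℓ(p) = inf_{q ∈ Δ^Y} L(p,q)`. -/
def genEnt [Fintype Y] (ℓ : Y → (Y → ℝ) → ℝ) (p : Y → ℝ) : ℝ :=
  sInf ((fun q => expLoss ℓ p q) '' simplex Y)

/-- Bregman divergence `d_ℓ(p,q) = L(p,q) − H_ℓ(p)`. -/
def breg [Fintype Y] (ℓ : Y → (Y → ℝ) → ℝ) (p q : Y → ℝ) : ℝ :=
  expLoss ℓ p q - genEnt ℓ p

/-- A probability mass function on `X × Y`. -/
def IsPMF [Fintype X] [Fintype Y] (P : X × Y → ℝ) : Prop :=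
  (∀ z, 0 ≤ P z) ∧ ∑ z, P z = 1

/-- The `X`-marginal `P_X(x) = Σ_y P(x,y)`. -/
def margX [Fintype Y] (P : X × Y → ℝ) (x : X) : ℝ := ∑ y, P (x, y)

/-- The conditional distribution `P(·|x)`. -/
def condY [Fintype Y] (P : X × Y → ℝ) (x : X) : Y → ℝ :=
  fun y => P (x, y) / margX P x

/-- Risk `R_P(h,ℓ) = Σ_{x,y} P(x,y)·ℓ(y,h(x))`. -/
def risk [Fintype X] [Fintype Y] (P : X × Y → ℝ) (h : X → Y → ℝ)
    (ℓ : Y → (Y → ℝ) → ℝ) : ℝ :=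
  ∑ z : X × Y, P z * ℓ z.2 (h z.1)

/-- The weight `w_ν = Σ_{x : h(x)=ν} P_X(x)`. -/
def weight [Fintype X] [Fintype Y] (P : X × Y → ℝ) (h : X → Y → ℝ) (ν : Y → ℝ) : ℝ :=
  ∑ x ∈ univ.filter (fun x => h x = ν), margX P x

/-- The conditional outcome distribution `P(·|h=ν)`. -/
def condOut [Fintype X] [Fintype Y] (P : X × Y → ℝ) (h : X → Y → ℝ) (ν : Y → ℝ) : Y → ℝ :=
  fun y => (∑ x ∈ univ.filter (fun x => h x = ν), P (x, y)) / weight P h ν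

/-- `h` is canonically calibrated under `P` if `P(·|h=ν) = ν` whenever `w_ν > 0`. -/
def Calibrated [Fintype X] [Fintype Y] (P : X × Y → ℝ) (h : X → Y → ℝ) : Prop :=
  ∀ ν : Y → ℝ, 0 < weight P h ν → condOut P h ν = ν

/-- Calibration error `CE_P(h,ℓ) = Σ_{ν : w_ν>0} w_ν · d_ℓ(P(·|h=ν), ν)`,
the sum ranging over the (finitely many) values in the range of `h`. -/
def CE [Fintype X] [Fintype Y] (P : X × Y → ℝ) (h : X → Y → ℝ)
    (ℓ : Y → (Y → ℝ) → ℝ) : ℝ :=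
  ∑ ν ∈ (univ.image h).filter (fun ν => 0 < weight P h ν),
    weight P h ν * breg ℓ (condOut P h ν) ν

/-- Refinement `RF_P(h,ℓ) = Σ_{ν : w_ν>0} w_ν · H_ℓ(P(·|h=ν))`. -/
def RF [Fintype X] [Fintype Y] (P : X × Y → ℝ) (h : X → Y → ℝ)
    (ℓ : Y → (Y → ℝ) → ℝ) : ℝ :=
  ∑ ν ∈ (univ.image h).filter (fun ν => 0 < weight P h ν),
    weight P h ν * genEnt ℓ (condOut P h ν)

/-- Bayes refinement `B_P(ℓ) = Σ_{x : P_X(x)>0} P_X(x) · H_ℓ(P(·|x))`. -/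
def BayesRF [Fintype X] [Fintype Y] (P : X × Y → ℝ) (ℓ : Y → (Y → ℝ) → ℝ) : ℝ :=
  ∑ x ∈ univ.filter (fun x => 0 < margX P x), margX P x * genEnt ℓ (condY P x)

/-- The optimal (Bayes) value `V(Q) = inf_{h : X → Δ^Y} R_Q(h,ℓ)`. -/
def mdlV [Fintype X] [Fintype Y] (ℓ : Y → (Y → ℝ) → ℝ) (Q : X × Y → ℝ) : ℝ :=
  sInf {r : ℝ | ∃ h : X → Y → ℝ, (∀ x, h x ∈ simplex Y) ∧ r = risk Q h ℓ}

lemma margX_nonneg [Fintype X] [Fintype Y] {P : X × Y → ℝ} (hP : IsPMF P) (x : X) :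
    0 ≤ margX P x :=
  sum_nonneg fun y _ => hP.1 (x, y)

lemma weight_nonneg [Fintype X] [Fintype Y] {P : X × Y → ℝ} (hP : IsPMF P)
    (h : X → Y → ℝ) (ν : Y → ℝ) : 0 ≤ weight P h ν :=
  sum_nonneg fun x _ => margX_nonneg hP x

lemma simplex_nonempty [Fintype Y] [Nonempty Y] : (simplex Y).Nonempty :=
  ⟨Pi.single (Classical.arbitrary Y) 1, single_mem_stdSimplex ℝ _⟩

lemma genEnt_le_expLoss [Fintype Y] {ℓ : Y → (Y → ℝ) → ℝ} {M : ℝ} (hb : IsBoundedLoss ℓ M)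
    {p q : Y → ℝ} (hp : ∀ y, 0 ≤ p y) (hq : q ∈ simplex Y) :
    genEnt ℓ p ≤ expLoss ℓ p q := by
  refine csInf_le ⟨0, ?_⟩ ⟨q, hq, rfl⟩
  rintro _ ⟨r, hr, rfl⟩
  exact sum_nonneg fun y _ => mul_nonneg (hp y) (hb y r hr).1

/-- The contribution of `x` to the Bayes refinement is at most the risk at `x` of any constant
prediction. -/
lemma margX_mul_genEnt_condY_le [Fintype X] [Fintype Y] {ℓ : Y → (Y → ℝ) → ℝ} {M : ℝ}
    (hb : IsBoundedLoss ℓ M) {P : X × Y → ℝ} (hP : IsPMF P) (x : X) {q : Y → ℝ}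
    (hq : q ∈ simplex Y) :
    margX P x * genEnt ℓ (condY P x) ≤ ∑ y, P (x, y) * ℓ y q := by
  rcases (margX_nonneg hP x).eq_or_lt with h0 | hpos
  · rw [← h0, zero_mul]
    exact sum_nonneg fun y _ => mul_nonneg (hP.1 _) (hb y q hq).1
  · calc margX P x * genEnt ℓ (condY P x)
        ≤ margX P x * expLoss ℓ (condY P x) q :=
          mul_le_mul_of_nonneg_left
            (genEnt_le_expLoss hb (fun y => div_nonneg (hP.1 _) hpos.le) hq) hpos.le
      _ = ∑ y, P (x, y) * ℓ y q := by
          rw [expLoss, mul_sum]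
          refine sum_congr rfl fun y _ => ?_
          rw [condY, ← mul_assoc, mul_div_cancel₀ _ hpos.ne']

lemma weight_mul_expLoss_condOut [Fintype X] [Fintype Y] (ℓ : Y → (Y → ℝ) → ℝ)
    {P : X × Y → ℝ} {h : X → Y → ℝ} {ν : Y → ℝ} (hw : 0 < weight P h ν) (q : Y → ℝ) :
    weight P h ν * expLoss ℓ (condOut P h ν) q =
      ∑ x ∈ univ.filter (fun x => h x = ν), ∑ y, P (x, y) * ℓ y q := by
  rw [expLoss, mul_sum, sum_comm]
  refine sum_congr rfl fun y _ => ?_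
  rw [condOut, ← mul_assoc, mul_div_cancel₀ _ hw.ne', sum_mul]

/-- On each level set of `h`, the entropy of the averaged conditional dominates the average of
the entropies. -/
lemma sum_margX_mul_genEnt_le_weight_mul [Fintype X] [Fintype Y] [Nonempty Y]
    {ℓ : Y → (Y → ℝ) → ℝ} {M : ℝ} (hb : IsBoundedLoss ℓ M) {P : X × Y → ℝ} (hP : IsPMF P)
    (h : X → Y → ℝ) (ν : Y → ℝ) :
    ∑ x ∈ univ.filter (fun x => h x = ν), margX P x * genEnt ℓ (condY P x) ≤
      weight P h ν * genEnt ℓ (condOut P h ν) := by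
  rcases (weight_nonneg hP h ν).eq_or_lt with h0 | hpos
  · have hz := (sum_eq_zero_iff_of_nonneg fun x _ => margX_nonneg hP x).1 h0.symm
    rw [← h0, zero_mul]
    exact (sum_eq_zero fun x hx => by rw [hz x hx, zero_mul]).le
  · rw [← div_le_iff₀' hpos]
    refine le_csInf (simplex_nonempty.image _) ?_
    rintro _ ⟨q, hq, rfl⟩
    rw [div_le_iff₀' hpos, weight_mul_expLoss_condOut ℓ hpos]
    exact sum_le_sum fun x _ => margX_mul_genEnt_condY_le hb hP x hq

lemma sum_filter_pos_mul {ι : Type*} (s : Finset ι) {w : ι → ℝ} (hw : ∀ i, 0 ≤ w i)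
    (f : ι → ℝ) : ∑ i ∈ s.filter (fun i => 0 < w i), w i * f i = ∑ i ∈ s, w i * f i :=
  sum_filter_of_ne fun i _ hi => (hw i).lt_of_ne' (left_ne_zero_of_mul hi)

/-- the refinement of any predictor is at least the expected generalized
entropy of the true conditional distributions, `RF_P(h,ℓ) ≥ B_P(ℓ)`. -/
theorem refinement_ge_bayes
    [Fintype X] [Fintype Y] [Nonempty X] [Nonempty Y]
    (ℓ : Y → (Y → ℝ) → ℝ) (M : ℝ) (hb : IsBoundedLoss ℓ M)
    (P : X × Y → ℝ) (hP : IsPMF P)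
    (h : X → Y → ℝ) (hh : ∀ x, h x ∈ simplex Y) :
    RF P h ℓ ≥ BayesRF P ℓ := by
  rw [ge_iff_le, BayesRF, RF, sum_filter_pos_mul _ (margX_nonneg hP),
    sum_filter_pos_mul _ (weight_nonneg hP h),
    ← sum_fiberwise_of_maps_to fun x _ => mem_image_of_mem h (mem_univ x)]
  exact sum_le_sum fun ν _ => sum_margX_mul_genEnt_le_weight_mul hb hP h ν

end
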